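/- Let p be a prime with p ≡ 1 (mod 4). Then any two finite connected non-bipartite graphs Γ and Γ' which are antipodal double covers of the complete graph K_{p+1} (so each has diameter 3, 2p+2 vertices, and fibres of size 2) and whose automorphism groups are isomorphic to PSL(2,p) × Z_2 are isomorphic graphs; moreover any such graph is geodesic transitive and has diameter 3. -/

import Mathlib

open SimpleGraph

/-- `Γ` is arc transitive: its automorphism group is transitive on ordered pairs
of adjacent vertices. -/
def ArcTransitive {V : Type*} (Γ : SimpleGraph V) : Prop :=
  ∀ ⦃v u v' u' : V⦄, Γ.Adj v u → Γ.Adj v' u' →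
    ∃ φ : Γ ≃g Γ, φ v = v' ∧ φ u = u'

/-- `(v,u,w)` is a 2-arc of `Γ`. -/
def Is2Arc {V : Type*} (Γ : SimpleGraph V) (v u w : V) : Prop :=
  Γ.Adj v u ∧ Γ.Adj u w ∧ v ≠ w

/-- `(v,u,w)` is a 2-geodesic of `Γ`: a 2-arc with `v`, `w` non-adjacent. -/
def Is2Geodesic {V : Type*} (Γ : SimpleGraph V) (v u w : V) : Prop :=
  Γ.Adj v u ∧ Γ.Adj u w ∧ v ≠ w ∧ ¬ Γ.Adj v w

/-- `Γ` is 2-arc transitive: arc transitive and transitive on 2-arcs. -/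
def TwoArcTransitive {V : Type*} (Γ : SimpleGraph V) : Prop :=
  ArcTransitive Γ ∧
  ∀ ⦃v u w v' u' w' : V⦄, Is2Arc Γ v u w → Is2Arc Γ v' u' w' →
    ∃ φ : Γ ≃g Γ, φ v = v' ∧ φ u = u' ∧ φ w = w'

/-- `Γ` is 2-geodesic transitive: arc transitive and transitive on 2-geodesics. -/
def TwoGeodesicTransitive {V : Type*} (Γ : SimpleGraph V) : Prop :=
  ArcTransitive Γ ∧
  ∀ ⦃v u w v' u' w' : V⦄, Is2Geodesic Γ v u w → Is2Geodesic Γ v' u' w' →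
    ∃ φ : Γ ≃g Γ, φ v = v' ∧ φ u = u' ∧ φ w = w'

/-- `Γ` is a (connected) antipodal double cover of the complete graph `K_{p+1}`:
it is connected of diameter `3`, has `2p+2` vertices, the relation «at distance `3`»
partitions the vertices into fibres of size `2` (each vertex has a unique antipode),
each vertex outside a fibre is adjacent to exactly one of its two vertices (so the
quotient graph on the `p+1` fibres is `K_{p+1}` and `Γ` covers it). -/
def IsAntipodalDoubleCoverOfComplete {V : Type*} (p : ℕ) (Γ : SimpleGraph V) : Prop :=
  Γ.Connected ∧
  (∀ x y : V, Γ.dist x y ≤ 3) ∧ (∃ x y : V, Γ.dist x y = 3) ∧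
  Nat.card V = 2 * p + 2 ∧
  (∀ v : V, ∃! v' : V, Γ.dist v v' = 3) ∧
  (∀ v x x' : V, Γ.dist x x' = 3 → v ≠ x → v ≠ x' → (Γ.Adj v x ↔ ¬ Γ.Adj v x'))

/-- `f 0, f 1, …, f i` is an `i`-geodesic of `Γ`: a path whose endpoints are at
graph distance `i`. -/
def IsIGeodesic {V : Type*} (Γ : SimpleGraph V) (i : ℕ) (f : ℕ → V) : Prop :=
  (∀ j < i, Γ.Adj (f j) (f (j + 1))) ∧ Γ.dist (f 0) (f i) = i

/-- `a` is a nonzero square. -/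
def NzSq {F : Type*} [Field F] (a : F) : Prop := ∃ s : F, s ≠ 0 ∧ a = s ^ 2

/-- The determinant of two plane vectors. -/
def det2 {F : Type*} [Field F] (x y : F × F) : F := x.1 * y.2 - x.2 * y.1

section Squares

variable {F : Type*} [Field F]

lemma NzSq.ne_zero {a : F} (h : NzSq a) : a ≠ 0 := by
  obtain ⟨s, hs, rfl⟩ := h
  exact pow_ne_zero 2 hs

lemma nzSq_sq {s : F} (hs : s ≠ 0) : NzSq (s ^ 2) := ⟨s, hs, rfl⟩

lemma nzSq_one : NzSq (1 : F) := ⟨1, one_ne_zero, by ring⟩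

lemma NzSq.mul {a b : F} (ha : NzSq a) (hb : NzSq b) : NzSq (a * b) := by
  obtain ⟨s, hs, rfl⟩ := ha
  obtain ⟨t, ht, rfl⟩ := hb
  exact ⟨s * t, mul_ne_zero hs ht, by ring⟩

lemma NzSq.div {a b : F} (ha : NzSq a) (hb : NzSq b) : NzSq (a / b) := by
  obtain ⟨s, hs, rfl⟩ := ha
  obtain ⟨t, ht, rfl⟩ := hb
  exact ⟨s / t, div_ne_zero hs ht, by field_simp⟩

lemma nzSq_mul_left_iff {a b : F} (ha : NzSq a) : NzSq (a * b) ↔ NzSq b := by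
  refine ⟨fun h => ?_, ha.mul⟩
  have := h.div ha
  rwa [mul_div_cancel_left₀ _ ha.ne_zero] at this

lemma nzSq_neg_iff (h1 : NzSq (-1 : F)) {a : F} : NzSq (-a) ↔ NzSq a := by
  rw [← neg_one_mul, nzSq_mul_left_iff h1]

lemma nzSq_sub_comm (h1 : NzSq (-1 : F)) {a b : F} : NzSq (a - b) ↔ NzSq (b - a) := by
  rw [← neg_sub, nzSq_neg_iff h1]

lemma nzSq_iff_isSquare {a : F} : NzSq a ↔ a ≠ 0 ∧ IsSquare a := by
  constructor
  · rintro ⟨s, hs, rfl⟩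
    exact ⟨pow_ne_zero 2 hs, s, by ring⟩
  · rintro ⟨ha, s, rfl⟩
    exact ⟨s, fun h => ha (by simp [h]), by ring⟩

lemma NzSq.mul_of_not [Finite F] {a b : F} (ha0 : a ≠ 0) (hb0 : b ≠ 0)
    (ha : ¬ NzSq a) (hb : ¬ NzSq b) : NzSq (a * b) := by
  classical
  have := Fintype.ofFinite F
  rw [nzSq_iff_isSquare] at *
  have ha' : quadraticChar F a = -1 :=
    quadraticChar_neg_one_iff_not_isSquare.2 fun h => ha ⟨ha0, h⟩
  have hb' : quadraticChar F b = -1 :=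
    quadraticChar_neg_one_iff_not_isSquare.2 fun h => hb ⟨hb0, h⟩
  refine ⟨mul_ne_zero ha0 hb0, (quadraticChar_one_iff_isSquare (mul_ne_zero ha0 hb0)).1 ?_⟩
  rw [map_mul, ha', hb', neg_one_mul, neg_neg]

lemma NzSq.div_of_not [Finite F] {a b : F} (ha0 : a ≠ 0) (hb0 : b ≠ 0)
    (ha : ¬ NzSq a) (hb : ¬ NzSq b) : NzSq (a / b) := by
  have h := (NzSq.mul_of_not ha0 hb0 ha hb).div (nzSq_sq hb0)
  rwa [pow_two, mul_div_mul_right _ _ hb0] at h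

lemma eq_smul_of_det2_eq_zero {x y : F × F} (hx : x ≠ 0) (h : det2 x y = 0) :
    ∃ c : F, y = c • x := by
  obtain ⟨a, b⟩ := x
  obtain ⟨c, d⟩ := y
  simp only [det2] at h
  by_cases ha : a = 0
  · have hb : b ≠ 0 := by
      rintro rfl
      exact hx (by simp [ha])
    subst ha
    have hc : c = 0 := by simpa [hb] using h
    exact ⟨d / b, by ext <;> simp [hc, hb]⟩
  · refine ⟨c / a, ?_⟩
    ext
    · simp [ha]
    · simp only [Prod.smul_mk, smul_eq_mul]
      field_simp
      linear_combination h

@[simp] lemma det2_smul_left (c : F) (x y : F × F) : det2 (c • x) y = c * det2 x y := by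
  simp [det2]; ring

@[simp] lemma det2_smul_right (c : F) (x y : F × F) : det2 x (c • y) = c * det2 x y := by
  simp [det2]; ring

lemma det2_comm (x y : F × F) : det2 x y = - det2 y x := by
  simp only [det2]; ring

@[simp] lemma det2_self (x : F × F) : det2 x x = 0 := by
  simp [det2, mul_comm]

/-- The linear map carrying `u` and `v` to `det2 u v` times `x` and `y`, respectively. -/
def basisMap (u v x y : F × F) : F × F →ₗ[F] F × F where
  toFun z := det2 z v • x + det2 u z • y
  map_add' z w := by ext <;> simp [det2] <;> ring
  map_smul' c z := by ext <;> simp [det2] <;> ring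

lemma basisMap_apply (u v x y z : F × F) :
    basisMap u v x y z = det2 z v • x + det2 u z • y := rfl

lemma det2_basisMap (u v x y z w : F × F) :
    det2 (basisMap u v x y z) (basisMap u v x y w) = det2 u v * det2 x y * det2 z w := by
  simp [basisMap_apply, det2]; ring

end Squares

/-- A labelling of the vertices of `Γ` by representatives of the nonzero plane vectors modulo
nonzero squares, for which adjacency means that the determinant is a nonzero square. -/
structure IsLabelling {V F : Type*} [Field F] (Γ : SimpleGraph V) (L : V → F × F) : Prop where
  ne_zero : ∀ x, L x ≠ 0
  adj_iff : ∀ x y, Γ.Adj x y ↔ NzSq (det2 (L x) (L y))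
  exists_rep : ∀ w : F × F, w ≠ 0 → ∃ x, ∃ s : F, s ≠ 0 ∧ w = s ^ 2 • L x
  inj : ∀ x y, ∀ s : F, s ≠ 0 → L y = s ^ 2 • L x → x = y

namespace IsLabelling

variable {V V' F : Type*} [Field F] {Γ : SimpleGraph V} {Γ' : SimpleGraph V'}
  {L : V → F × F} {L' : V' → F × F}

lemma exists_iso [Fintype V] [Fintype V'] (hL : IsLabelling Γ L) (hL' : IsLabelling Γ' L')
    (hcard : Fintype.card V = Fintype.card V') (g : F × F →ₗ[F] F × F) {k : F} (hk : NzSq k)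
    (hg : ∀ x y, det2 (g x) (g y) = k * det2 x y) :
    ∃ φ : Γ ≃g Γ', ∀ x y, ∀ s : F, s ≠ 0 → g (L x) = s ^ 2 • L' y → φ x = y := by
  have hg0 : ∀ z, g z = 0 → z = 0 := fun z hz => by
    have h : ∀ y, det2 z y = 0 := fun y => by
      have := hg z y
      rw [hz] at this
      simpa [det2, hk.ne_zero] using this.symm
    have h1 := h (0, 1)
    have h2 := h (1, 0)
    ext <;> simp_all [det2]
  choose φ s hs hφ using fun x => hL'.exists_rep (g (L x)) (mt (hg0 _) (hL.ne_zero x))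
  have hinj : Function.Injective φ := by
    intro x y hxy
    refine hL.inj x y (s y / s x) (div_ne_zero (hs y) (hs x)) ?_
    rw [← sub_eq_zero]
    apply hg0
    rw [map_sub, map_smul, hφ, hφ, hxy, smul_smul, ← sub_smul]
    have := hs x
    have h0 : s y ^ 2 - (s y / s x) ^ 2 * s x ^ 2 = 0 := by field_simp; ring
    rw [h0, zero_smul]
  have hbij : Function.Bijective φ :=
    (Fintype.bijective_iff_injective_and_card φ).2 ⟨hinj, hcard⟩
  refine ⟨⟨Equiv.ofBijective φ hbij, fun {x y} => ?_⟩, fun x y t ht h => ?_⟩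
  · have h := hg (L x) (L y)
    rw [hφ, hφ, det2_smul_left, det2_smul_right] at h
    rw [hL.adj_iff, ← nzSq_mul_left_iff hk, ← h, nzSq_mul_left_iff (nzSq_sq (hs x)),
      nzSq_mul_left_iff (nzSq_sq (hs y)), ← hL'.adj_iff]
    rfl
  · refine hL'.inj _ _ (s x / t) (div_ne_zero (hs x) ht) ?_
    have h2 : t ^ 2 • L' y = s x ^ 2 • L' (φ x) := by rw [← h, hφ]
    rw [div_pow, div_eq_inv_mul, mul_smul]
    change L' y = (t ^ 2)⁻¹ • s x ^ 2 • L' (φ x)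
    rw [← h2, smul_smul, inv_mul_cancel₀ (pow_ne_zero 2 ht), one_smul]

lemma exists_aut_of_adj [Fintype V] (hL : IsLabelling Γ L) {u v u' v' : V}
    (h : Γ.Adj u v) (h' : Γ.Adj u' v') : ∃ φ : Γ ≃g Γ, φ u = u' ∧ φ v = v' := by
  rw [hL.adj_iff] at h h'
  obtain ⟨φ, hφ⟩ := hL.exists_iso hL rfl (basisMap (L u) (L v) (L u') (L v')) (h.mul h')
    (det2_basisMap _ _ _ _)
  obtain ⟨s, hs, hs'⟩ := h
  refine ⟨φ, hφ _ _ s hs ?_, hφ _ _ s hs ?_⟩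
  · rw [basisMap_apply, hs']
    simp
  · rw [basisMap_apply, hs']
    simp

lemma det2_ne_zero_of_is2Geodesic (hL : IsLabelling Γ L) {u v w : V} (h : Is2Geodesic Γ u v w) :
    det2 (L u) (L w) ≠ 0 := by
  obtain ⟨huv, hvw, hne, -⟩ := h
  intro h0
  obtain ⟨c, hc⟩ := eq_smul_of_det2_eq_zero (hL.ne_zero u) h0
  rw [Γ.adj_comm, hL.adj_iff] at huv
  rw [hL.adj_iff, hc, det2_smul_right] at hvw
  have h2 := hvw.div huv
  rw [mul_div_cancel_right₀ _ huv.ne_zero] at h2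
  obtain ⟨s, hs, rfl⟩ := h2
  exact hne (hL.inj u w s hs hc)

lemma exists_aut_of_is2Geodesic [Fintype V] [Finite F] (hL : IsLabelling Γ L) {u v w u' v' w' : V}
    (h : Is2Geodesic Γ u v w) (h' : Is2Geodesic Γ u' v' w') :
    ∃ φ : Γ ≃g Γ, φ u = u' ∧ φ v = v' ∧ φ w = w' := by
  have hne := hL.det2_ne_zero_of_is2Geodesic h
  have hne' := hL.det2_ne_zero_of_is2Geodesic h'
  obtain ⟨huv, hvw, -, huw⟩ := h
  obtain ⟨huv', hvw', -, huw'⟩ := h'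
  rw [hL.adj_iff] at huv hvw huw huv' hvw' huw'
  have ha := hvw'.div hvw
  have hb := NzSq.div_of_not hne' hne huw' huw
  set α := det2 (L v') (L w') / det2 (L v) (L w) with hα
  set β := det2 (L u') (L w') / det2 (L u) (L w) with hβ
  obtain ⟨φ, hφ⟩ := hL.exists_iso hL rfl
    (basisMap (L u) (L v) (α • L u') (β • L v')) (k := det2 (L u) (L v) *
      (α * (β * det2 (L u') (L v')))) (huv.mul (ha.mul (hb.mul huv')))
    (fun x y => by rw [det2_basisMap, det2_smul_left, det2_smul_right])
  obtain ⟨s, hs, hs'⟩ := huv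
  obtain ⟨s₂, hs₂, hs₂'⟩ := huv'
  obtain ⟨t, ht, ht'⟩ := ha
  obtain ⟨r, hr, hr'⟩ := hb
  refine ⟨φ, hφ _ _ (s * t) (mul_ne_zero hs ht) ?_, hφ _ _ (s * r) (mul_ne_zero hs hr) ?_,
    hφ _ _ s₂ hs₂ ?_⟩
  · rw [basisMap_apply, hs', ht', smul_smul, mul_pow]
    simp
  · rw [basisMap_apply, hs', hr', smul_smul, mul_pow]
    simp [mul_smul]
  · rw [basisMap_apply, smul_smul, smul_smul, ← hs₂', hα, hβ, det2_comm (L w) (L v),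
      mul_div_cancel₀ _ hne, neg_mul, mul_div_cancel₀ _ hvw.ne_zero]
    ext <;> simp [det2] <;> ring

end IsLabelling

/-- Representatives of the nonzero plane vectors modulo nonzero squares, for a nonsquare `ε`. -/
def modelVector {F : Type*} [Field F] (ε : F) (a : Option F × Bool) : F × F :=
  (if a.2 then ε else 1) • a.1.elim (1, 0) fun i => (i, 1)

lemma isLabelling_modelVector {V F : Type*} [Field F] [Finite F] {Γ : SimpleGraph V} {ε : F}
    (hε0 : ε ≠ 0) (hε : ¬ NzSq ε) (e : Option F × Bool ≃ V)
    (hadj : ∀ a b, Γ.Adj (e a) (e b) ↔ NzSq (det2 (modelVector ε a) (modelVector ε b))) :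
    IsLabelling Γ fun x => modelVector ε (e.symm x) := by
  have key : ∀ c : F, c ≠ 0 → ∃ b : Bool, ∃ s : F, s ≠ 0 ∧ c = s ^ 2 * (if b then ε else 1) := by
    intro c hc
    by_cases h : NzSq c
    · obtain ⟨s, hs, rfl⟩ := h
      exact ⟨false, s, hs, by simp⟩
    · obtain ⟨s, hs, h⟩ := NzSq.div_of_not hc hε0 h hε
      exact ⟨true, s, hs, by simp [← h, hε0]⟩
  refine ⟨fun x => ?_, fun x y => ?_, fun w hw => ?_, fun x y s hs h => ?_⟩
  · obtain ⟨⟨_ | i, b⟩, rfl⟩ := e.surjective x <;> cases b <;> simp [modelVector, hε0]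
  · rw [← hadj, e.apply_symm_apply, e.apply_symm_apply]
  · obtain ⟨a, c⟩ := w
    by_cases hc : c = 0
    · subst hc
      obtain ⟨b, s, hs, h⟩ := key a (by rintro rfl; exact hw rfl)
      refine ⟨e (none, b), s, hs, ?_⟩
      cases b <;> simp [modelVector, h]
    · obtain ⟨b, s, hs, h⟩ := key c hc
      refine ⟨e (some (a / c), b), s, hs, ?_⟩
      rw [e.symm_apply_apply, modelVector, smul_smul, ← h]
      simp [mul_div_cancel₀ _ hc]
  · obtain ⟨⟨o, b⟩, rfl⟩ := e.surjective x
    obtain ⟨⟨o', b'⟩, rfl⟩ := e.surjective y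
    simp only [e.symm_apply_apply] at h
    have h1 : ε ≠ s ^ 2 := fun h => hε ⟨s, hs, h⟩
    have h2 : s ^ 2 * ε ≠ 1 := fun h => hε ⟨s⁻¹, inv_ne_zero hs, by
      rw [inv_pow]; exact eq_inv_of_mul_eq_one_right h⟩
    have h3 := pow_ne_zero 2 hs
    clear hadj key
    congr 1
    rcases o with _ | i <;> rcases o' with _ | j <;> cases b <;> cases b' <;>
      simp only [modelVector, Option.elim, if_true, Bool.false_eq_true, if_false, one_smul,
        Prod.smul_mk, smul_eq_mul, Prod.mk.injEq, mul_one, mul_zero] at h ⊢ <;> grind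

section DoubleCover

variable {V : Type*} {Γ : SimpleGraph V} {p : ℕ}

lemma SimpleGraph.Iso.dist_apply (hΓ : Γ.Connected) (φ : Γ ≃g Γ) (x y : V) :
    Γ.dist (φ x) (φ y) = Γ.dist x y := by
  have key : ∀ (ψ : Γ ≃g Γ) (x y : V), Γ.dist (ψ x) (ψ y) ≤ Γ.dist x y := fun ψ x y => by
    obtain ⟨w, hw⟩ := hΓ.exists_walk_length_eq_dist x y
    rw [← hw, ← w.length_map ψ.toHom]
    exact SimpleGraph.dist_le _
  refine le_antisymm (key φ x y) ?_
  simpa using key φ.symm (φ x) (φ y)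

/-- `τ` is an automorphism of `Γ` interchanging the two vertices of each fibre of a double cover of
a complete graph. -/
structure IsAntipodalMap (Γ : SimpleGraph V) (τ : Γ ≃g Γ) : Prop where
  apply_apply : ∀ x, τ (τ x) = x
  ne_self : ∀ x, τ x ≠ x
  not_adj_self : ∀ x, ¬ Γ.Adj x (τ x)
  adj_apply_iff : ∀ x y, y ≠ x → y ≠ τ x → (Γ.Adj x (τ y) ↔ ¬ Γ.Adj x y)
  comm : ∀ (φ : Γ ≃g Γ) (x : V), φ (τ x) = τ (φ x)

lemma IsAntipodalDoubleCoverOfComplete.exists_isAntipodalMap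
    (hΓ : IsAntipodalDoubleCoverOfComplete p Γ) : ∃ τ, IsAntipodalMap Γ τ := by
  obtain ⟨hconn, -, -, -, hu, hadj⟩ := hΓ
  choose τ hτ hτu using hu
  simp only at hτ hτu
  have hττ : ∀ x, τ (τ x) = x := fun x =>
    (hτu (τ x) x (by rw [SimpleGraph.dist_comm, hτ])).symm
  have hne : ∀ x, τ x ≠ x := fun x h => by
    have := hτ x
    rw [h, SimpleGraph.dist_self] at this
    omega
  have hna : ∀ x, ¬ Γ.Adj x (τ x) := fun x h => by
    have := hτ x
    rw [SimpleGraph.dist_eq_one_iff_adj.2 h] at this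
    omega
  have hiff : ∀ x y, y ≠ x → y ≠ τ x → (Γ.Adj x (τ y) ↔ ¬ Γ.Adj x y) := fun x y h1 h2 => by
    have := hadj x y (τ y) (hτ y) h1.symm (by rintro rfl; exact h2 (hττ y).symm)
    tauto
  have hmap : ∀ x y, Γ.Adj x y → Γ.Adj (τ x) (τ y) := fun x y h => by
    have h1 : x ≠ y := h.ne
    have h2 : y ≠ τ x := by rintro rfl; exact hna _ h
    have h3 : ¬ Γ.Adj y (τ x) := by
      rw [Γ.adj_comm, ← hττ x] at h
      have := hiff y (τ x) h2.symm (fun h => h1 (by rw [← hττ x, h, hττ]))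
      tauto
    rw [hiff _ _ h2 (by rw [hττ]; exact h1.symm), Γ.adj_comm]
    exact h3
  refine ⟨⟨⟨τ, τ, hττ, hττ⟩, fun {x y} => ⟨fun h => ?_, hmap x y⟩⟩, hττ, hne, hna, hiff,
    fun φ x => hτu _ _ ?_⟩
  · have := hmap _ _ h
    simpa [hττ] using this
  · rw [SimpleGraph.Iso.dist_apply hconn]
    exact hτ x

namespace IsAntipodalMap

variable {τ : Γ ≃g Γ} (hτ : IsAntipodalMap Γ τ)
include hτ

lemma ne_apply_of_adj {x y : V} (h : Γ.Adj x y) : y ≠ τ x := by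
  rintro rfl
  exact hτ.not_adj_self _ h

lemma not_adj_apply_of_adj {x y : V} (h : Γ.Adj x y) : ¬ Γ.Adj x (τ y) := by
  rw [hτ.adj_apply_iff _ _ h.ne' (hτ.ne_apply_of_adj h)]
  exact not_not.2 h

lemma adj_or_adj_apply {x y : V} (h1 : y ≠ x) (h2 : y ≠ τ x) : Γ.Adj x y ∨ Γ.Adj x (τ y) := by
  rw [hτ.adj_apply_iff _ _ h1 h2]
  exact em _

end IsAntipodalMap

/-- Given a vertex `v` and a parametrization `X` of its neighbours, the parametrization of all
vertices of a double cover of a complete graph. -/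
def coverPoint {F : Type*} (τ : Γ ≃g Γ) (v : V) (X : F → V) (a : Option F × Bool) : V :=
  if a.2 then τ (a.1.elim v X) else a.1.elim v X

section CoverPoint

variable {F : Type*} {τ : Γ ≃g Γ} {v : V} {X : F → V}

@[simp] lemma coverPoint_false (o : Option F) : coverPoint τ v X (o, false) = o.elim v X := rfl

@[simp] lemma coverPoint_true (o : Option F) : coverPoint τ v X (o, true) = τ (o.elim v X) := rfl

variable (hτ : IsAntipodalMap Γ τ) (hX : Function.Injective X) (hv : ∀ i, Γ.Adj v (X i))
include hτ hX hv

lemma coverPoint_injective : Function.Injective (coverPoint τ v X) := by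
  have h1 : ∀ i, X i ≠ v := fun i => (hv i).ne'
  have h2 : ∀ i, X i ≠ τ v := fun i => hτ.ne_apply_of_adj (hv i)
  have h3 : ∀ i, τ (X i) ≠ v := fun i h => h2 i (by rw [← h, hτ.apply_apply])
  have h4 : ∀ i j, X i ≠ τ (X j) := fun i j h => by
    have := hv i
    rw [h] at this
    exact hτ.not_adj_apply_of_adj (hv j) this
  have h5 : ∀ i, v ≠ X i := fun i => (h1 i).symm
  have h6 : ∀ i, τ v ≠ X i := fun i => (h2 i).symm
  have h7 : ∀ i, v ≠ τ (X i) := fun i => (h3 i).symm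
  have h8 : ∀ i j, τ (X j) ≠ X i := fun i j => (h4 i j).symm
  rintro ⟨_ | i, _ | _⟩ ⟨_ | j, _ | _⟩ h <;>
    simp_all [hτ.ne_self, (hτ.ne_self _).symm, hX.eq_iff]

lemma coverPoint_bijective [Fintype V] [Fintype F]
    (hcard : Fintype.card V = 2 * Fintype.card F + 2) :
    Function.Bijective (coverPoint τ v X) := by
  rw [Fintype.bijective_iff_injective_and_card]
  refine ⟨coverPoint_injective hτ hX hv, ?_⟩
  simp only [Fintype.card_prod, Fintype.card_option, Fintype.card_bool, hcard]
  ring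

lemma adj_coverPoint_iff (o o' : Option F) (b b' : Bool) :
    Γ.Adj (coverPoint τ v X (o, b)) (coverPoint τ v X (o', b')) ↔
      o ≠ o' ∧ (b = b' ↔ Γ.Adj (o.elim v X) (o'.elim v X)) := by
  have hinj := coverPoint_injective hτ hX hv
  by_cases ho : o = o'
  · subst ho
    cases b <;> cases b' <;> simp [hτ.not_adj_self]
    rw [Γ.adj_comm]
    exact hτ.not_adj_self _
  · have h1 : o'.elim v X ≠ o.elim v X := fun h =>
      ho (congrArg Prod.fst (@hinj (o', false) (o, false) h)).symm
    have h2 : o'.elim v X ≠ τ (o.elim v X) := fun h =>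
      ho (congrArg Prod.fst (@hinj (o', false) (o, true) h)).symm
    have h3 := hτ.adj_apply_iff _ _ h1 h2
    have h4 : Γ.Adj (τ (o.elim v X)) (o'.elim v X) ↔ ¬ Γ.Adj (o.elim v X) (o'.elim v X) := by
      rw [← τ.map_adj_iff, hτ.apply_apply, h3]
    cases b <;> cases b' <;> simp [ho, h3, h4, τ.map_adj_iff]

lemma isLabelling_of_adj_iff_nzSq [Field F] [Fintype F] [Fintype V] (h1 : NzSq (-1 : F))
    {ε : F} (hε0 : ε ≠ 0) (hε : ¬ NzSq ε) (hcard : Fintype.card V = 2 * Fintype.card F + 2)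
    (hadj : ∀ i j, Γ.Adj (X i) (X j) ↔ NzSq (j - i)) : ∃ L : V → F × F, IsLabelling Γ L := by
  refine ⟨_, isLabelling_modelVector hε0 hε
    (Equiv.ofBijective _ (coverPoint_bijective hτ hX hv hcard)) ?_⟩
  rintro ⟨o, b⟩ ⟨o', b'⟩
  have hbase : Γ.Adj (o.elim v X) (o'.elim v X) ↔
      NzSq (det2 (o.elim (1, 0) fun i => (i, 1)) (o'.elim (1, 0) fun i => (i, 1) : F × F)) := by
    rcases o with _ | i <;> rcases o' with _ | j
    · simpa [det2] using fun h : NzSq (0 : F) => h.ne_zero rfl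
    · simpa [det2, hv] using nzSq_one
    · simpa [det2, (hv i).symm] using h1
    · simpa [det2, hadj] using nzSq_sub_comm h1
  have hne : o ≠ o' →
      det2 (o.elim (1, 0) fun i => (i, 1)) (o'.elim (1, 0) fun i => (i, 1) : F × F) ≠ 0 := by
    rcases o with _ | i <;> rcases o' with _ | j <;> simp [det2, sub_eq_zero]
  have hmul : ∀ d : F, d ≠ 0 → (NzSq (ε * d) ↔ ¬ NzSq d) := fun d hd => by
    refine ⟨fun h h' => hε ?_, fun h => NzSq.mul_of_not hε0 hd hε h⟩
    have := h.div h'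
    rwa [mul_div_cancel_right₀ _ hd] at this
  rw [Equiv.ofBijective_apply, Equiv.ofBijective_apply, adj_coverPoint_iff hτ hX hv, hbase]
  by_cases ho : o = o'
  · subst ho
    cases b <;> cases b' <;>
      simpa [modelVector, -Prod.smul_mk] using fun h : NzSq (0 : F) => h.ne_zero rfl
  · have h2 := hmul _ (hne ho)
    cases b <;> cases b' <;>
      simp [modelVector, -Prod.smul_mk, ho, h2, ← mul_assoc, ← pow_two,
        nzSq_mul_left_iff (nzSq_sq hε0)]

lemma colorable_two_of_forall_not_adj [Fintype V] [Fintype F]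
    (hcard : Fintype.card V = 2 * Fintype.card F + 2)
    (hadj : ∀ i j, ¬ Γ.Adj (X i) (X j)) : Γ.Colorable 2 := by
  let e := Equiv.ofBijective _ (coverPoint_bijective hτ hX hv hcard)
  refine SimpleGraph.Coloring.colorable
    (SimpleGraph.Coloring.mk (fun x => xor (e.symm x).2 (e.symm x).1.isSome) ?_ : Γ.Coloring Bool)
  intro x y h
  obtain ⟨⟨o, b⟩, rfl⟩ := e.surjective x
  obtain ⟨⟨o', b'⟩, rfl⟩ := e.surjective y
  have h2 := (adj_coverPoint_iff hτ hX hv o o' b b').1 h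
  simp only [e.symm_apply_apply]
  rcases o with _ | i <;> rcases o' with _ | j <;> cases b <;> cases b' <;>
    simp_all [fun i => (hv i).symm]

lemma not_connected_of_forall_adj [Fintype V] [Fintype F]
    (hcard : Fintype.card V = 2 * Fintype.card F + 2)
    (hadj : ∀ i j, i ≠ j → Γ.Adj (X i) (X j)) : ¬ Γ.Connected := by
  intro hconn
  let e := Equiv.ofBijective _ (coverPoint_bijective hτ hX hv hcard)
  have hstep : ∀ x y, Γ.Adj x y → (e.symm x).2 = (e.symm y).2 := by
    intro x y h
    obtain ⟨⟨o, b⟩, rfl⟩ := e.surjective x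
    obtain ⟨⟨o', b'⟩, rfl⟩ := e.surjective y
    have h2 := (adj_coverPoint_iff hτ hX hv o o' b b').1 h
    simp only [e.symm_apply_apply]
    refine h2.2.2 ?_
    rcases o with _ | i <;> rcases o' with _ | j
    · exact absurd rfl h2.1
    · exact hv j
    · exact (hv i).symm
    · exact hadj i j fun h => h2.1 (by rw [h])
  have hwalk : ∀ x y, Γ.Walk x y → (e.symm x).2 = (e.symm y).2 := fun x y w => by
    induction w with
    | nil => rfl
    | cons h _ ih => exact (hstep _ _ h).trans ih
  obtain ⟨w⟩ := hconn.preconnected (e (none, false)) (e (none, true))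
  have := hwalk _ _ w
  simp at this

lemma exists_isLabelling_of_quadratic_connection [Field F] [Fintype F] [Fintype V]
    (h1 : NzSq (-1 : F)) {ε : F} (hε0 : ε ≠ 0) (hε : ¬ NzSq ε)
    (hcard : Fintype.card V = 2 * Fintype.card F + 2) (hconn : Γ.Connected)
    (hbip : ¬ Γ.Colorable 2) {S : F → Prop} (hadj : ∀ i j, Γ.Adj (X i) (X j) ↔ S (j - i))
    (hS : ∀ a, a ≠ 0 → ∀ i, S (a ^ 2 * i) ↔ S i) : ∃ L : V → F × F, IsLabelling Γ L := by
  have hS0 : ¬ S 0 := fun h => by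
    rw [← sub_self 0, ← hadj] at h
    exact Γ.loopless.irrefl _ h
  have hquot : ∀ i j, i ≠ 0 → NzSq (j / i) → S i → S j := by
    rintro i j hi ⟨s, hs, h⟩ hi'
    rw [div_eq_iff hi] at h
    rw [h]
    exact (hS s hs i).2 hi'
  by_cases hsq : ∃ i, NzSq i ∧ S i
  · obtain ⟨i, hi, hi'⟩ := hsq
    have hsq' : ∀ j, NzSq j → S j := fun j hj => hquot i j hi.ne_zero (hj.div hi) hi'
    by_cases hns : ∃ j, ¬ NzSq j ∧ S j
    · obtain ⟨j, hj, hj'⟩ := hns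
      have hj0 : j ≠ 0 := by rintro rfl; exact hS0 hj'
      refine absurd hconn (not_connected_of_forall_adj hτ hX hv hcard fun k l hkl => ?_)
      rw [hadj]
      have h0 : l - k ≠ 0 := sub_ne_zero.2 hkl.symm
      by_cases h : NzSq (l - k)
      · exact hsq' _ h
      · exact hquot j _ hj0 (NzSq.div_of_not h0 hj0 h hj) hj'
    · refine isLabelling_of_adj_iff_nzSq hτ hX hv h1 hε0 hε hcard fun k l => ?_
      rw [hadj]
      exact ⟨fun h => by_contra fun h' => hns ⟨_, h', h⟩, hsq' _⟩
  · by_cases hns : ∃ j, ¬ NzSq j ∧ S j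
    · obtain ⟨j, hj, hj'⟩ := hns
      have hj0 : j ≠ 0 := by rintro rfl; exact hS0 hj'
      refine isLabelling_of_adj_iff_nzSq (X := fun i => X (ε * i)) hτ
        (fun i k h => mul_left_cancel₀ hε0 (hX h)) (fun i => hv _) h1 hε0 hε hcard fun k l => ?_
      rw [hadj, ← mul_sub]
      refine ⟨fun h => by_contra fun h' => hsq ⟨_, ?_, h⟩, fun h => hquot j _ hj0 ?_ hj'⟩
      · refine NzSq.mul_of_not hε0 (fun h0 => hS0 ?_) hε h'
        rwa [h0, mul_zero] at h
      · rw [mul_div_right_comm]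
        exact (NzSq.div_of_not hε0 hj0 hε hj).mul h
    · refine absurd (colorable_two_of_forall_not_adj hτ hX hv hcard fun k l h => ?_) hbip
      rw [hadj] at h
      by_cases h' : NzSq (l - k)
      · exact hsq ⟨_, h', h⟩
      · exact hns ⟨_, h', h⟩

end CoverPoint

/-- If `U` is an automorphism of prime order `p` which is conjugate to its powers with nonzero square
exponents, then the neighbours of some vertex are parametrized by the integers modulo `p`, with
adjacency depending only on the difference and invariant under multiplication by squares. -/
lemma exists_cyclic_parametrization [Fintype V] [Fact p.Prime] (hp2 : p ≠ 2)
    (hcard : Fintype.card V = 2 * p + 2) {τ : Γ ≃g Γ} (hτ : IsAntipodalMap Γ τ)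
    {U : Γ ≃g Γ} (hU1 : U ≠ 1) (hUp : U ^ p = 1)
    (hD : ∀ a : ZMod p, a ≠ 0 → ∃ D : Γ ≃g Γ, U * D = D * U ^ (a ^ 2).val) :
    ∃ (v : V) (X : ZMod p → V) (S : ZMod p → Prop), Function.Injective X ∧
      (∀ i, Γ.Adj v (X i)) ∧ (∀ i j, Γ.Adj (X i) (X j) ↔ S (j - i)) ∧
      ∀ a, a ≠ 0 → ∀ i, S (a ^ 2 * i) ↔ S i := by
  classical
  have hp : p.Prime := Fact.out
  obtain ⟨v, hv⟩ : ∃ v, U v = v := by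
    by_contra! hno
    let f : Function.End V := fun x => U x
    have hf : ∀ n : ℕ, f ^ n = fun x => (U ^ n) x := fun n => by
      induction n with
      | zero => rfl
      | succ n ih => rw [pow_succ, ih, pow_succ]; rfl
    have hpow : f ^ p ^ 1 = 1 := by
      rw [pow_one, hf, hUp]
      rfl
    have h := Equiv.Perm.card_fixedPoints_modEq hpow
    have h0 : Fintype.card (Function.fixedPoints f) = 0 :=
      Fintype.card_eq_zero_iff.2 ⟨fun x => hno _ x.2⟩
    have h2 : p ∣ 2 * p + 2 := by
      rw [← hcard]
      exact Nat.modEq_zero_iff_dvd.1 (h0 ▸ h)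
    have h3 : p ∣ 2 := (Nat.dvd_add_right (Dvd.intro_left 2 rfl)).1 h2
    exact hp2 ((Nat.prime_dvd_prime_iff_eq hp Nat.prime_two).1 h3)
  have hUτ : ∀ x, U (τ x) = τ (U x) := hτ.comm U
  obtain ⟨x₀, hx₀, hx₀U⟩ : ∃ x, Γ.Adj v x ∧ U x ≠ x := by
    by_contra! hno
    refine hU1 (RelIso.ext fun x => ?_)
    change U x = x
    by_cases h1 : x = v
    · rw [h1, hv]
    by_cases h2 : x = τ v
    · rw [h2, hUτ, hv]
    rcases hτ.adj_or_adj_apply h1 h2 with h | h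
    · exact hno x h
    · have h3 := hno _ h
      rw [hUτ] at h3
      exact τ.injective h3
  have hUv : ∀ n : ℕ, (U ^ n) v = v := fun n => by
    induction n with
    | zero => rfl
    | succ n ih => rw [pow_succ, RelIso.mul_apply, hv, ih]
  set X : ZMod p → V := fun i => (U ^ i.val) x₀ with hXdef
  have hXn : ∀ n : ℕ, (U ^ n) x₀ = X n := fun n => by
    rw [hXdef]
    simp only [ZMod.val_natCast]
    rw [← pow_eq_pow_mod n hUp]
  have hXadd : ∀ (n : ℕ) (i : ZMod p), (U ^ n) (X i) = X (n + i) := fun n i => by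
    have : X (n + i) = X ((n + i.val : ℕ) : ZMod p) := by simp
    rw [this, ← hXn, pow_add]
    rfl
  have hX0 : X 0 = x₀ := by rw [hXdef]; simp
  have hUX : ∀ i, U (X i) = X (1 + i) := fun i => by simpa using hXadd 1 i
  have hXinj : Function.Injective X := by
    intro i j hij
    by_contra hne
    have hk : i - j ≠ 0 := sub_ne_zero.2 hne
    have hk' : X (i - j) = x₀ := by
      have h := congrArg (U ^ (-j).val) hij
      rw [hXadd, hXadd, ZMod.natCast_zmod_val, neg_add_cancel, hX0] at h
      rw [sub_eq_neg_add, h]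
    have hmul : ∀ n : ℕ, X (n * (i - j)) = x₀ := fun n => by
      induction n with
      | zero => simpa using hX0
      | succ n ih =>
        have h := hXadd (i - j).val (n * (i - j))
        rw [ih, ZMod.natCast_zmod_val] at h
        rw [Nat.cast_succ, add_mul, one_mul, add_comm, ← h]
        exact hk'
    have h := hmul (i - j)⁻¹.val
    rw [ZMod.natCast_zmod_val, inv_mul_cancel₀ hk] at h
    have h2 := hUX 0
    rw [add_zero, h, hX0] at h2
    exact hx₀U h2
  have hvX : ∀ i, Γ.Adj v (X i) := fun i => by
    rw [← hUv i.val]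
    exact (U ^ i.val).map_adj_iff.2 hx₀
  have hsurj : ∀ y, y = v ∨ y = τ v ∨ (∃ i, y = X i) ∨ ∃ i, y = τ (X i) := fun y => by
    obtain ⟨⟨_ | i, _ | _⟩, rfl⟩ := (coverPoint_bijective hτ hXinj hvX
      (by rw [ZMod.card, hcard])).surjective y
    · exact Or.inl rfl
    · exact Or.inr (Or.inl rfl)
    · exact Or.inr (Or.inr (Or.inl ⟨i, rfl⟩))
    · exact Or.inr (Or.inr (Or.inr ⟨i, rfl⟩))
  have hUXne : ∀ i, U (X i) ≠ X i := fun i h => by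
    rw [hUX] at h
    simpa using hXinj h
  have hfix : ∀ y, U y = y → y = v ∨ y = τ v := fun y hy => by
    rcases hsurj y with h | h | ⟨i, rfl⟩ | ⟨i, rfl⟩
    · exact Or.inl h
    · exact Or.inr h
    · exact absurd hy (hUXne i)
    · rw [hUτ] at hy
      exact absurd (τ.injective hy) (hUXne i)
  refine ⟨v, X, fun i => Γ.Adj (X 0) (X i), hXinj, hvX, fun i j => ?_, fun a ha i => ?_⟩
  · simp only
    rw [← (U ^ i.val).map_adj_iff (v := X 0), hXadd, hXadd]
    simp
  · obtain ⟨D, hDv, hDU⟩ : ∃ D : Γ ≃g Γ, D v = v ∧ ∀ x, U (D x) = D ((U ^ (a ^ 2).val) x) := by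
      obtain ⟨D, hD⟩ := hD a ha
      have hD' : ∀ x, U (D x) = D ((U ^ (a ^ 2).val) x) := fun x => congrArg (· x) hD
      rcases hfix (D v) (by rw [hD', hUv]) with h | h
      · exact ⟨D, h, hD'⟩
      · refine ⟨τ * D, ?_, fun x => ?_⟩
        · rw [RelIso.mul_apply, h, hτ.apply_apply]
        · rw [RelIso.mul_apply, hUτ, hD', RelIso.mul_apply]
    have hDUn : ∀ (n : ℕ) x, (U ^ n) (D x) = D (((U ^ (a ^ 2).val) ^ n) x) := fun n x => by
      induction n with
      | zero => rfl
      | succ n ih => rw [pow_succ', RelIso.mul_apply, ih, hDU, pow_succ' (U ^ _), RelIso.mul_apply]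
    obtain ⟨k, hk⟩ : ∃ k, D x₀ = X k := by
      have hadj : Γ.Adj v (D x₀) := by
        rw [← hDv]
        exact D.map_adj_iff.2 hx₀
      rcases hsurj (D x₀) with h | h | h | ⟨j, h⟩
      · exact absurd h hadj.ne'
      · exact absurd h (hτ.ne_apply_of_adj hadj)
      · exact h
      · rw [h] at hadj
        exact absurd hadj (hτ.not_adj_apply_of_adj (hvX j))
    have hDX : ∀ i, D (X (a ^ 2 * i)) = X (i + k) := fun i => by
      have h := hDUn i.val x₀
      rw [hk, hXadd, ← pow_mul, hXn, Nat.cast_mul] at h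
      simpa only [ZMod.natCast_zmod_val] using h.symm
    have h := hDX 0
    rw [mul_zero] at h
    simp only
    rw [← D.map_adj_iff, h, hDX, ← (U ^ k.val).map_adj_iff (v := X 0), hXadd, hXadd]
    simp [add_comm]

end DoubleCover

section ProjectiveGroup

open Matrix Matrix.SpecialLinearGroup

lemma transvection_pow {F : Type*} [Field F] (b : F) (n : ℕ) :
    transvection (zero_ne_one : (0 : Fin 2) ≠ 1) b ^ n =
      transvection (zero_ne_one : (0 : Fin 2) ≠ 1) (n * b) := by
  induction n with
  | zero => simp [transvection_coeff_zero]
  | succ n ih =>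
    rw [pow_succ, ih]
    ext i j
    fin_cases i <;> fin_cases j <;>
      simp [transvection_coe, Matrix.mul_apply, Fin.sum_univ_two, add_mul]
    ring

/-- The diagonal matrix with entries `a⁻¹` and `a`. -/
def diagInv {F : Type*} [Field F] (a : F) (ha : a ≠ 0) : SpecialLinearGroup (Fin 2) F :=
  ⟨!![a⁻¹, 0; 0, a], by simp [Matrix.det_fin_two, ha]⟩

lemma transvection_mul_diagInv {F : Type*} [Field F] (a : F) (ha : a ≠ 0) :
    transvection (zero_ne_one : (0 : Fin 2) ≠ 1) 1 * diagInv a ha =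
      diagInv a ha * transvection (zero_ne_one : (0 : Fin 2) ≠ 1) (a ^ 2) := by
  refine Subtype.ext ?_
  rw [coe_mul, coe_mul, transvection_coe, transvection_coe]
  ext i j
  fin_cases i <;> fin_cases j <;>
    simp [diagInv, Matrix.mul_apply, Fin.sum_univ_two]
  field_simp

lemma exists_unipotent_of_mulEquiv {p : ℕ} [Fact p.Prime] {G : Type*} [Group G]
    (e : G ≃* (SpecialLinearGroup (Fin 2) (ZMod p) ⧸
        Subgroup.center (SpecialLinearGroup (Fin 2) (ZMod p))) × Multiplicative (ZMod 2)) :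
    ∃ U : G, U ≠ 1 ∧ U ^ p = 1 ∧
      ∀ a : ZMod p, a ≠ 0 → ∃ D : G, U * D = D * U ^ (a ^ 2).val := by
  let f : SpecialLinearGroup (Fin 2) (ZMod p) →* G := e.symm.toMonoidHom.comp
    ((MonoidHom.inl _ _).comp (QuotientGroup.mk' (Subgroup.center _)))
  refine ⟨f (transvection (zero_ne_one : (0 : Fin 2) ≠ 1) 1), fun h => ?_, ?_,
    fun a ha => ⟨f (diagInv a ha), ?_⟩⟩
  · have h2 := (map_eq_one_iff e.symm e.symm.injective).1 h
    have h3 := (QuotientGroup.eq_one_iff _).1 (congrArg Prod.fst h2)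
    exact one_ne_zero ((transvection_mem_center_iff _ _).1 h3)
  · rw [← map_pow, transvection_pow, CharP.cast_eq_zero, zero_mul, transvection_coeff_zero, map_one]
  · rw [← map_pow, ← map_mul, ← map_mul, transvection_mul_diagInv, transvection_pow,
      ZMod.natCast_zmod_val, mul_one]

end ProjectiveGroup

lemma exists_isLabelling {p : ℕ} [Fact p.Prime] (hp4 : p % 4 = 1) {V : Type*} [Fintype V]
    {Γ : SimpleGraph V} (hΓ : IsAntipodalDoubleCoverOfComplete p Γ) (hbip : ¬ Γ.Colorable 2)
    (haut : Nonempty ((Γ ≃g Γ) ≃*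
      (Matrix.SpecialLinearGroup (Fin 2) (ZMod p) ⧸
        Subgroup.center (Matrix.SpecialLinearGroup (Fin 2) (ZMod p))) ×
      Multiplicative (ZMod 2))) : ∃ L : V → ZMod p × ZMod p, IsLabelling Γ L := by
  have hp2 : p ≠ 2 := by omega
  obtain ⟨τ, hτ⟩ := hΓ.exists_isAntipodalMap
  have hcard : Fintype.card V = 2 * p + 2 := by rw [← Nat.card_eq_fintype_card, hΓ.2.2.2.1]
  obtain ⟨e⟩ := haut
  obtain ⟨U, hU1, hUp, hD⟩ := exists_unipotent_of_mulEquiv e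
  obtain ⟨v, X, S, hX, hv, hadj, hS⟩ := exists_cyclic_parametrization hp2 hcard hτ hU1 hUp hD
  have h1 : NzSq (-1 : ZMod p) :=
    nzSq_iff_isSquare.2 ⟨by simp, ZMod.exists_sq_eq_neg_one_iff.2 (by omega)⟩
  obtain ⟨ε, hε⟩ := FiniteField.exists_nonsquare (F := ZMod p) (by rwa [ZMod.ringChar_zmod_n])
  exact exists_isLabelling_of_quadratic_connection hτ hX hv h1
    (ε := ε) (by rintro rfl; exact hε IsSquare.zero) (fun h => hε (nzSq_iff_isSquare.1 h).2)
    (by rw [ZMod.card, hcard]) hΓ.1 hbip hadj hS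

lemma IsAntipodalDoubleCoverOfComplete.diam_eq {p : ℕ} {V : Type*} [Finite V] {Γ : SimpleGraph V}
    (hΓ : IsAntipodalDoubleCoverOfComplete p Γ) : Γ.diam = 3 := by
  obtain ⟨hconn, hle, ⟨x, y, hxy⟩, -⟩ := hΓ
  have := hconn.nonempty
  obtain ⟨u, v, huv⟩ := Γ.exists_dist_eq_diam
  refine le_antisymm (huv ▸ hle u v) (hxy ▸ SimpleGraph.dist_le_diam ?_)
  exact SimpleGraph.connected_iff_ediam_ne_top.1 hconn

lemma is2Geodesic_of_two_le_dist {V : Type*} {Γ : SimpleGraph V}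
    {u v w : V} (huv : Γ.Adj u v) (hvw : Γ.Adj v w) (h : 2 ≤ Γ.dist u w) :
    Is2Geodesic Γ u v w := by
  refine ⟨huv, hvw, ?_, fun h' => ?_⟩
  · rintro rfl
    simp at h
  · rw [SimpleGraph.dist_eq_one_iff_adj.2 h'] at h
    omega

theorem stmt19 (p : ℕ) (hp : p.Prime) (hp4 : p % 4 = 1)
    {V V' : Type*} [Fintype V] [Fintype V']
    (Γ : SimpleGraph V) (Γ' : SimpleGraph V')
    (hΓ : IsAntipodalDoubleCoverOfComplete p Γ)
    (hΓ' : IsAntipodalDoubleCoverOfComplete p Γ')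
    (hbip : ¬ Γ.Colorable 2) (hbip' : ¬ Γ'.Colorable 2)
    (haut : Nonempty ((Γ ≃g Γ) ≃*
      (Matrix.SpecialLinearGroup (Fin 2) (ZMod p) ⧸
        Subgroup.center (Matrix.SpecialLinearGroup (Fin 2) (ZMod p))) ×
      Multiplicative (ZMod 2)))
    (haut' : Nonempty ((Γ' ≃g Γ') ≃*
      (Matrix.SpecialLinearGroup (Fin 2) (ZMod p) ⧸
        Subgroup.center (Matrix.SpecialLinearGroup (Fin 2) (ZMod p))) ×
      Multiplicative (ZMod 2))) :
    Nonempty (Γ ≃g Γ') ∧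
    Γ.diam = 3 ∧
    (∀ i : ℕ, 1 ≤ i → i ≤ 3 →
      ∀ f g : ℕ → V, IsIGeodesic Γ i f → IsIGeodesic Γ i g →
        ∃ φ : Γ ≃g Γ, ∀ j ≤ i, φ (f j) = g j) := by
  have := Fact.mk hp
  obtain ⟨L, hL⟩ := exists_isLabelling hp4 hΓ hbip haut
  obtain ⟨L', hL'⟩ := exists_isLabelling hp4 hΓ' hbip' haut'
  refine ⟨?_, hΓ.diam_eq, fun i hi1 hi3 f g ⟨hf, hfd⟩ ⟨hg, hgd⟩ => ?_⟩
  · have hcard : Fintype.card V = Fintype.card V' := by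
      rw [← Nat.card_eq_fintype_card, ← Nat.card_eq_fintype_card, hΓ.2.2.2.1, hΓ'.2.2.2.1]
    obtain ⟨φ, -⟩ := hL.exists_iso hL' hcard LinearMap.id nzSq_one (by simp)
    exact ⟨φ⟩
  obtain rfl | rfl | rfl : i = 1 ∨ i = 2 ∨ i = 3 := by omega
  · obtain ⟨φ, h0, h1⟩ := hL.exists_aut_of_adj (hf 0 (by omega)) (hg 0 (by omega))
    exact ⟨φ, fun j hj => by interval_cases j <;> assumption⟩
  · obtain ⟨φ, h0, h1, h2⟩ := hL.exists_aut_of_is2Geodesic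
      (is2Geodesic_of_two_le_dist (hf 0 (by omega)) (hf 1 (by omega)) hfd.ge)
      (is2Geodesic_of_two_le_dist (hg 0 (by omega)) (hg 1 (by omega)) hgd.ge)
    exact ⟨φ, fun j hj => by interval_cases j <;> assumption⟩
  · have hd : ∀ f : ℕ → V, Γ.Adj (f 2) (f 3) → Γ.dist (f 0) (f 3) = 3 →
        2 ≤ Γ.dist (f 0) (f 2) := fun f h h3 => by
      have := hΓ.1.dist_triangle (u := f 0) (v := f 2) (w := f 3)
      rw [SimpleGraph.dist_eq_one_iff_adj.2 h] at this
      omega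
    obtain ⟨φ, h0, h1, h2⟩ := hL.exists_aut_of_is2Geodesic
      (is2Geodesic_of_two_le_dist (hf 0 (by omega)) (hf 1 (by omega))
        (hd f (hf 2 (by omega)) hfd))
      (is2Geodesic_of_two_le_dist (hg 0 (by omega)) (hg 1 (by omega))
        (hd g (hg 2 (by omega)) hgd))
    have h3 : φ (f 3) = g 3 := by
      refine (hΓ.2.2.2.2.1 (g 0)).unique ?_ hgd
      rw [← h0, SimpleGraph.Iso.dist_apply hΓ.1, hfd]
    exact ⟨φ, fun j hj => by interval_cases j <;> assumption⟩
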